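/- Let (Δ, c⃗, ε⃗) be a semitoric polygon representative with hidden and Delzant corners p₁, …, p_d, and let P be a semitoric packing with λᵢ the SL₂(ℤ)-size of the triangle packed at pᵢ (0 if none). Then λᵢ ≤ αᵢ for all i ∈ {1, …, d}, where αᵢ = min over all marked points c_j whose vertical line meets a semitoric edge emanating from pᵢ of (a_iʲ + b_iʲ·|v₁ⁱ − w₁ⁱ|) (and αᵢ = ∞ if there is no such j). -/

import Mathlib

open Matrix MeasureTheory Set

/-- Points of the plane. -/
abbrev Pt := Fin 2 → ℝ

/-- The action of `SL₂(ℤ)` on `ℝ²` by matrix-vector multiplication. -/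
noncomputable def sl2Apply (M : Matrix.SpecialLinearGroup (Fin 2) ℤ) (x : Pt) : Pt :=
  ((M : Matrix (Fin 2) (Fin 2) ℤ).map (Int.cast : ℤ → ℝ)).mulVec x

/-- The model triangle `B(λ) = {(x,y) : x ≥ 0, y ≥ 0, x + y < λ}`. -/
def modelTriangle (lam : ℝ) : Set Pt :=
  {x | 0 ≤ x 0 ∧ 0 ≤ x 1 ∧ x 0 + x 1 < lam}

/-- The area (Lebesgue measure) of a subset of the plane. -/
noncomputable def area (S : Set Pt) : ℝ := (volume S).toReal

/-- The element of the group `𝒯 × G_m` determined by a global power `n` of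
`T = [[1,0],[1,1]]`, a vertical translation `t`, and cut flips `u` (with `u j ∈ {0, ε_j}`;
flipping the cut at the marked point `c j` applies `T^{± 1}` on the half-plane to its
right), as a piecewise affine map of the plane. -/
noncomputable def stMap {m : ℕ} (c : Fin m → Pt) (n : ℤ) (t : ℝ) (u : Fin m → ℤ)
    (x : Pt) : Pt :=
  ![x 0, x 1 + (n : ℝ) * x 0 + t + ∑ j, (u j : ℝ) * max (x 0 - c j 0) 0]

/-- `B` is an admissibly packed triangle of `SL₂(ℤ)`-size `lam` at the point `p` of the
semitoric polygon with underlying set `Δ`, marked points `c` and cut directions `eps`: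
in some equivalent representative (image under an element `σ` of `𝒯 × G_m`), `σ(B)` has
the form `M(B(lam)) + σ(p)` with `M ∈ SL₂(ℤ)`, coincides with the polygon near `σ(p)`,
and contains no marked point. -/
def IsSTPackedTriangleIn {m : ℕ} (Δ : Set Pt) (c : Fin m → Pt) (eps : Fin m → ℤ)
    (p : Pt) (lam : ℝ) (B : Set Pt) : Prop :=
  0 < lam ∧ B ⊆ Δ ∧ (∀ j, c j ∉ B) ∧
  ∃ (n : ℤ) (t : ℝ) (u : Fin m → ℤ), (∀ j, u j = 0 ∨ u j = eps j) ∧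
    (∃ M : Matrix.SpecialLinearGroup (Fin 2) ℤ,
        stMap c n t u '' B =
          (fun x => sl2Apply M x + stMap c n t u p) '' modelTriangle lam) ∧
    ∃ U : Set Pt, IsOpen U ∧ stMap c n t u p ∈ U ∧
      (stMap c n t u '' B) ∩ U = (stMap c n t u '' Δ) ∩ U

/-- `P` is a semitoric packing of the semitoric polygon `(Δ, c, eps)`: a finite union of
pairwise disjoint admissibly packed triangles, at most one at each vertex. -/
def IsSTPackingIn {m : ℕ} (Δ : Set Pt) (c : Fin m → Pt) (eps : Fin m → ℤ)
    (P : Set Pt) : Prop :=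
  ∃ (N : ℕ) (pt : Fin N → Pt) (lam : Fin N → ℝ) (tri : Fin N → Set Pt),
    P = (⋃ a, tri a) ∧ Function.Injective pt ∧
    (∀ a, pt a ∈ Set.extremePoints ℝ Δ) ∧
    (∀ a, IsSTPackedTriangleIn Δ c eps (pt a) (lam a) (tri a)) ∧
    Pairwise (Function.onFun Disjoint tri)

/-- The set of densities `area P / area Δ` of semitoric packings `P` of `(Δ, c, eps)`;
the semitoric packing density `ρ_ST` is its supremum. -/
def stDensitySet {m : ℕ} (Δ : Set Pt) (c : Fin m → Pt) (eps : Fin m → ℤ) : Set ℝ :=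
  {r : ℝ | ∃ P, IsSTPackingIn Δ c eps P ∧ r = area P / area Δ}

/-- The determinant of a pair of integer vectors in the plane. -/
def detZ (u v : Fin 2 → ℤ) : ℤ := u 0 * v 1 - u 1 * v 0

/-- The matrix `Tⁿ`, where `T = [[1,0],[1,1]]`. -/
def Tpow (n : ℤ) : Matrix (Fin 2) (Fin 2) ℤ := !![1, 0; n, 1]

/-- The combinatorial data of a semitoric polygon representative: a convex polygon with
vertices `V i` listed in clockwise order, the edge from `V i` to `V (i+1)` directed along
the primitive integer vector `dir i` with `SL₂(ℤ)`-length `len i`, together with marked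
points `c j` and cut directions `eps j ∈ {±1}`. -/
structure STRep (d m : ℕ) where
  V : Fin d → Pt
  dir : Fin d → Fin 2 → ℤ
  len : Fin d → ℝ
  c : Fin m → Pt
  eps : Fin m → ℤ

namespace STRep

variable {d m : ℕ}

/-- The underlying polygon (as a subset of the plane). -/
noncomputable def carrier (R : STRep d m) : Set Pt := convexHull ℝ (Set.range R.V)

/-- The cut of the marked point `c j` (the vertical ray from `c j` in the direction
`eps j`) meets the boundary of the polygon at the point `z`. -/
def CutHits (R : STRep d m) (j : Fin m) (z : Pt) : Prop :=
  z ∈ frontier R.carrier ∧ z 0 = R.c j 0 ∧ 0 ≤ (R.eps j : ℝ) * (z 1 - R.c j 1)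

/-- The number of cuts meeting the boundary of the polygon at the vertex `V i`. -/
noncomputable def numCuts (R : STRep d m) (i : Fin d) : ℕ :=
  Set.ncard {j | R.CutHits j (R.V i)}

/-- The first primitive integer vector emanating from the vertex `V i`
(so that `det (u1, u2) > 0` for a clockwise polygon). -/
def u1 [NeZero d] (R : STRep d m) (i : Fin d) : Fin 2 → ℤ := fun k => - R.dir (i - 1) k

/-- The second primitive integer vector emanating from the vertex `V i`. -/
def u2 (R : STRep d m) (i : Fin d) : Fin 2 → ℤ := R.dir i

/-- The vertex `V i` is a fake corner: at least one cut meets it and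
`det (u₁, Tᵏ u₂) = 0` where `k` is the number of cuts meeting it. -/
def IsFakeCorner [NeZero d] (R : STRep d m) (i : Fin d) : Prop :=
  0 < R.numCuts i ∧ detZ (R.u1 i) ((Tpow (R.numCuts i : ℤ)).mulVec (R.u2 i)) = 0

/-- The vertex `V i` is a hidden or Delzant corner (i.e. not a fake corner). -/
def IsHDCorner [NeZero d] (R : STRep d m) (i : Fin d) : Prop := ¬ R.IsFakeCorner i

/-- `R` is a valid semitoric polygon representative: the polygon is convex and rational
with vertices in clockwise order, the marked points lie in the interior, the cut
directions are `±1`, every point where exactly `k ≥ 1` cuts meet the boundary is a vertex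
satisfying the fake (`det (u₁, Tᵏ u₂) = 0`) or hidden (`det (u₁, Tᵏ u₂) = 1`) corner
condition, and every other vertex satisfies the Delzant condition
`det (u₁, u₂) = ±1`. -/
structure IsValid [NeZero d] (R : STRep d m) : Prop where
  three_le : 3 ≤ d
  len_pos : ∀ i, 0 < R.len i
  primitive : ∀ i, Int.gcd (R.dir i 0) (R.dir i 1) = 1
  edge_eq : ∀ i k, R.V (i + 1) k - R.V i k = R.len i * (R.dir i k : ℝ)
  clockwise : ∀ i, detZ (R.dir i) (R.dir (i + 1)) < 0
  edges_boundary : ∀ i, segment ℝ (R.V i) (R.V (i + 1)) ⊆ frontier R.carrier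
  marked_interior : ∀ j, R.c j ∈ interior R.carrier
  eps_pm : ∀ j, R.eps j = 1 ∨ R.eps j = -1
  cuts_at_vertices : ∀ j z, R.CutHits j z → ∃ i, z = R.V i
  corner_delzant : ∀ i, R.numCuts i = 0 →
    detZ (R.u1 i) (R.u2 i) = 1 ∨ detZ (R.u1 i) (R.u2 i) = -1
  corner_cut : ∀ i, 0 < R.numCuts i →
    detZ (R.u1 i) ((Tpow (R.numCuts i : ℤ)).mulVec (R.u2 i)) = 0 ∨
    detZ (R.u1 i) ((Tpow (R.numCuts i : ℤ)).mulVec (R.u2 i)) = 1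

end STRep

/-- An admissibly packed triangle in the semitoric polygon representative `R`. -/
def IsSTPackedTriangle {d m : ℕ} (R : STRep d m) (p : Pt) (lam : ℝ) (B : Set Pt) :
    Prop :=
  IsSTPackedTriangleIn R.carrier R.c R.eps p lam B

/-- `g` enumerates the hidden and Delzant corners of `R` in (clockwise) cyclic order:
`g` is strictly monotone and its range is exactly the set of hidden/Delzant corners. -/
def IsCornerEnum {d m D : ℕ} [NeZero d] (R : STRep d m) (g : Fin D → Fin d) : Prop :=
  StrictMono g ∧ ∀ i, R.IsHDCorner i ↔ ∃ a, g a = i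

/-- `P` is a semitoric packing of `R` whose triangle at the hidden/Delzant corner
`V (g a)` has `SL₂(ℤ)`-size `sz a` (with `sz a = 0` if no triangle is packed there). -/
def IsSTPacking {d m D : ℕ} (R : STRep d m) (g : Fin D → Fin d)
    (sz : Fin D → ℝ) (P : Set Pt) : Prop :=
  ∃ tri : Fin D → Set Pt,
    P = (⋃ a, tri a) ∧
    (∀ a, (sz a = 0 ∧ tri a = ∅) ∨
       IsSTPackedTriangle R (R.V (g a)) (sz a) (tri a)) ∧
    Pairwise (Function.onFun Disjoint tri)

/-- The number of steps from `s` to `i` going cyclically forwards in `Fin d`. -/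
def distCyc {d : ℕ} (s i : Fin d) : ℕ := (i.val + d - s.val) % d

/-- The number of edges in the cyclic chain of edges from vertex `s` to vertex `e`
(the whole cycle when `e = s`). -/
def chainLen {d : ℕ} (s e : Fin d) : ℕ := if e = s then d else distCyc s e

/-- The `SL₂(ℤ)`-length `ℓ_a` of the `a`-th semitoric edge: the sum of the
`SL₂(ℤ)`-lengths of the edges in the chain (joined at fake corners) connecting the
hidden/Delzant corner `V (g a)` to the next one `V (g (a+1))`. -/
noncomputable def stEdgeLen {d m D : ℕ} [NeZero D] (R : STRep d m) (g : Fin D → Fin d)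
    (a : Fin D) : ℝ :=
  ∑ i : Fin d, if distCyc (g a) i < chainLen (g a) (g (a + 1)) then R.len i else 0

/-- The point `q` lies on one of the two semitoric edges emanating from the
hidden/Delzant corner `V (g a)`, and `t` is the `SL₂(ℤ)`-length of the boundary path
(contained in that single semitoric edge) from `V (g a)` to `q`. -/
def OnEmanating {d m D : ℕ} [NeZero D] (R : STRep d m) (g : Fin D → Fin d)
    (a : Fin D) (q : Pt) (t : ℝ) : Prop :=
  (∃ (i : Fin d) (s : ℝ), distCyc (g a) i < chainLen (g a) (g (a + 1)) ∧
      0 ≤ s ∧ s ≤ R.len i ∧ (∀ k, q k = R.V i k + s * (R.dir i k : ℝ)) ∧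
      t = (∑ i' : Fin d, if distCyc (g a) i' < distCyc (g a) i then R.len i' else 0) + s) ∨
  (∃ (i : Fin d) (s : ℝ), distCyc (g (a - 1)) i < chainLen (g (a - 1)) (g a) ∧
      0 ≤ s ∧ s ≤ R.len i ∧ (∀ k, q k = R.V i k + s * (R.dir i k : ℝ)) ∧
      t = (∑ i' : Fin d, if distCyc (g (a - 1)) i < distCyc (g (a - 1)) i' ∧
              distCyc (g (a - 1)) i' < chainLen (g (a - 1)) (g a) then R.len i' else 0)
          + (R.len i - s))

/-- `lam ≤ α_a`, where `α_a` is the marked-point bound at the hidden/Delzant corner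
`V (g a)`: for each marked point `c j` whose vertical line meets a semitoric edge
emanating from `V (g a)`, taking the intersection point `q` whose boundary path from the
corner has minimal `SL₂(ℤ)`-length `t`, one has `lam ≤ t + b · |v₁ − w₁|`, where `b` is
the vertical distance from `c j` to `q` and `v, w` are the primitive integer vectors
directing the edges emanating from the corner. (`α_a = ∞` when there is no such marked
point, in which case this is no condition.) -/
def AlphaBound {d m D : ℕ} [NeZero d] [NeZero D] (R : STRep d m) (g : Fin D → Fin d)
    (a : Fin D) (lam : ℝ) : Prop :=
  ∀ (j : Fin m) (q : Pt) (t : ℝ),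
    OnEmanating R g a q t → q 0 = R.c j 0 →
    (∀ (q' : Pt) (t' : ℝ), OnEmanating R g a q' t' → q' 0 = R.c j 0 → t ≤ t') →
    lam ≤ t + |q 1 - R.c j 1| * |((R.dir (g a) 0 + R.dir (g a - 1) 0 : ℤ) : ℝ)|

/-- The polytope `𝒫̃_ST` of admissible size tuples:
`sz a ≥ 0`, `sz a + sz (a+1) ≤ ℓ_a` and `sz a ≤ α_a` for all `a` (cyclically). -/
def STPolytope {d m D : ℕ} [NeZero d] [NeZero D] (R : STRep d m)
    (g : Fin D → Fin d) : Set (Fin D → ℝ) :=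
  {sz | ∀ a, 0 ≤ sz a ∧ sz a + sz (a + 1) ≤ stEdgeLen R g a ∧ AlphaBound R g a (sz a)}

/-- The convex set obtained from a convex set by the shear `y ↦ y ± (x - T₀)⁺` when the set lies
below (or above) two lines through its point `T` whose slopes differ by at least one. -/
theorem convex_image_shear {C : Set Pt} (hC : Convex ℝ C) {T : Pt} (hT : T ∈ C) {κ aR aL : ℝ}
    (hκ : κ = 1 ∨ κ = -1) (ha : aR + 1 ≤ aL)
    (hr : ∀ z ∈ C, T 0 ≤ z 0 → κ * (z 1 - T 1) ≤ aR * (z 0 - T 0))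
    (hl : ∀ z ∈ C, z 0 ≤ T 0 → κ * (z 1 - T 1) ≤ aL * (z 0 - T 0)) :
    Convex ℝ ((fun z : Pt => (![z 0, z 1 + κ * max (z 0 - T 0) 0] : Pt)) '' C) := by
  have key : ∀ z ∈ C, ∀ w ∈ C, z 0 < T 0 → T 0 < w 0 → ∀ a b : ℝ, 0 ≤ a → 0 ≤ b → a + b = 1 →
      (![a * z 0 + b * w 0, a * z 1 + b * (w 1 + κ * (w 0 - T 0)) -
        κ * max (a * z 0 + b * w 0 - T 0) 0] : Pt) ∈ C := by
    intro z hz w hw hz0 hw0 a b ha0 hb0 hab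
    set a' := (w 0 - T 0) / (w 0 - z 0) with ha'
    set b' := (T 0 - z 0) / (w 0 - z 0) with hb'
    have hpos : 0 < w 0 - z 0 := by linarith
    have ha'0 : 0 < a' := div_pos (by linarith) hpos
    have hb'0 : 0 < b' := div_pos (by linarith) hpos
    have hab' : a' + b' = 1 := by rw [ha', hb']; field_simp; ring
    have hx' : a' * z 0 + b' * w 0 = T 0 := by rw [ha', hb']; field_simp; ring
    have hO := hC hz hw ha'0.le hb'0.le hab'
    have hQ : (![T 0, a' * z 1 + b' * (w 1 + κ * (w 0 - T 0))] : Pt) ∈ C := by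
      have h1 := hl z hz hz0.le
      have h2 := hr w hw hw0.le
      have h3 : κ * (a' * z 1 + b' * (w 1 + κ * (w 0 - T 0)) - T 1) ≤ 0 := by
        have e1 : κ * κ = 1 := by rcases hκ with h | h <;> rw [h] <;> norm_num
        have e2 : κ * (a' * z 1 + b' * (w 1 + κ * (w 0 - T 0)) - T 1) =
            a' * (κ * (z 1 - T 1)) + b' * (κ * (w 1 - T 1)) + b' * (w 0 - T 0) := by
          have : a' = 1 - b' := by linarith
          rw [this]
          linear_combination b' * (w 0 - T 0) * e1
        have e3 : b' * (w 0 - T 0) = a' * (T 0 - z 0) := by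
          have : a' = 1 - b' := by linarith
          rw [this] at hx' ⊢
          linarith
        have e4 := mul_le_mul_of_nonneg_left h1 ha'0.le
        have e5 := mul_le_mul_of_nonneg_left h2 hb'0.le
        have e6 := mul_le_mul_of_nonneg_right ha (mul_pos ha'0 (sub_pos.2 hz0)).le
        have e7 : b' * (aR * (w 0 - T 0)) = aR * (a' * (T 0 - z 0)) := by rw [← e3]; ring
        rw [e2]
        linarith
      have h4 : 0 < b' * (w 0 - T 0) := mul_pos hb'0 (by linarith)
      -- the point lies on the vertical segment between the chord of `C` and `T`
      set g := b' * (w 0 - T 0) with hg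
      set r := κ * (T 1 - (a' * z 1 + b' * w 1)) with hrdef
      have hgr : g ≤ r := by
        have e1 : κ * κ = 1 := by rcases hκ with h | h <;> rw [h] <;> norm_num
        have : κ * (a' * z 1 + b' * (w 1 + κ * (w 0 - T 0)) - T 1) = g - r := by
          rw [hg, hrdef]; linear_combination b' * (w 0 - T 0) * e1
        linarith
      have hr0 : 0 < r := by linarith
      have hmem := hC hO hT (a := 1 - g / r) (b := g / r)
        (by rw [sub_nonneg, div_le_one hr0]; exact hgr) (by positivity) (by ring)
      convert hmem using 1
      have e8 : g / r * r = g := by field_simp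
      ext k
      fin_cases k
      · simp only [Fin.zero_eta, Matrix.cons_val_zero, Pi.add_apply, Pi.smul_apply, smul_eq_mul]
        rw [hx']; ring
      · simp only [Fin.mk_one, Matrix.cons_val_one, Pi.add_apply, Pi.smul_apply, smul_eq_mul,
          Matrix.cons_val_fin_one]
        have e1 : κ * κ = 1 := by rcases hκ with h | h <;> rw [h] <;> norm_num
        have e9 : κ * r = T 1 - (a' * z 1 + b' * w 1) := by
          rw [hrdef]; linear_combination (T 1 - (a' * z 1 + b' * w 1)) * e1
        have : κ * g = g / r * (T 1 - (a' * z 1 + b' * w 1)) := by rw [← e9, ← e8]; field_simp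
        rw [hg] at this
        rw [hg]
        linear_combination this
    rcases le_total (a * z 0 + b * w 0) (T 0) with hx | hx
    · rw [max_eq_right (by linarith)]
      have hb1 : b ≤ b' := by
        have e1 : a = 1 - b := by linarith
        have e2 : a' = 1 - b' := by linarith
        rw [e1] at hx
        rw [e2] at hx'
        by_contra! h
        nlinarith
      have hmem := hC hz hQ (a := 1 - b / b') (b := b / b')
        (by rw [sub_nonneg, div_le_one hb'0]; exact hb1) (by positivity) (by ring)
      convert hmem using 1
      have e8 : b / b' * b' = b := by field_simp
      have e9 : a = 1 - b / b' + b / b' * a' := by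
        have : a' = 1 - b' := by linarith
        rw [this]; linarith
      ext k
      fin_cases k
      · simp only [Fin.zero_eta, Matrix.cons_val_zero, Pi.add_apply, Pi.smul_apply, smul_eq_mul]
        rw [← hx']
        linear_combination z 0 * e9 - w 0 * e8
      · simp only [Fin.mk_one, Matrix.cons_val_one, Pi.add_apply, Pi.smul_apply, smul_eq_mul,
          Matrix.cons_val_fin_one]
        linear_combination z 1 * e9 - (w 1 + κ * (w 0 - T 0)) * e8
    · rw [max_eq_left (by linarith)]
      have ha1 : a ≤ a' := by
        have e1 : b = 1 - a := by linarith
        have e2 : b' = 1 - a' := by linarith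
        rw [e1] at hx
        rw [e2] at hx'
        by_contra! h
        nlinarith
      have hmem := hC hQ hw (a := a / a') (b := 1 - a / a') (by positivity)
        (by rw [sub_nonneg, div_le_one ha'0]; exact ha1) (by ring)
      convert hmem using 1
      have e8 : a / a' * a' = a := by field_simp
      have e9 : b = 1 - a / a' + a / a' * b' := by
        have : b' = 1 - a' := by linarith
        rw [this]; linarith
      ext k
      fin_cases k
      · simp only [Fin.zero_eta, Matrix.cons_val_zero, Pi.add_apply, Pi.smul_apply, smul_eq_mul]
        rw [← hx']
        linear_combination w 0 * e9 - z 0 * e8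
      · simp only [Fin.mk_one, Matrix.cons_val_one, Pi.add_apply, Pi.smul_apply, smul_eq_mul,
          Matrix.cons_val_fin_one]
        have e10 : a * z 0 + b * w 0 - T 0 = (1 - a / a') * (w 0 - T 0) := by
          linear_combination w 0 * e9 - z 0 * e8 + (a / a') * hx'
        rw [e10]
        linear_combination (w 1 + κ * (w 0 - T 0)) * e9 - z 1 * e8
  rintro _ ⟨z, hz, rfl⟩ _ ⟨w, hw, rfl⟩ a b ha0 hb0 hab
  refine ⟨![a * z 0 + b * w 0, a * (z 1 + κ * max (z 0 - T 0) 0) +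
    b * (w 1 + κ * max (w 0 - T 0) 0) - κ * max (a * z 0 + b * w 0 - T 0) 0], ?_, ?_⟩
  · have hzw := hC hz hw ha0 hb0 hab
    have same : max (a * z 0 + b * w 0 - T 0) 0 = a * max (z 0 - T 0) 0 + b * max (w 0 - T 0) 0 →
        (![a * z 0 + b * w 0, a * (z 1 + κ * max (z 0 - T 0) 0) +
          b * (w 1 + κ * max (w 0 - T 0) 0) - κ * max (a * z 0 + b * w 0 - T 0) 0] : Pt) ∈ C := by
      intro h
      convert hzw using 1
      ext k
      fin_cases k
      · simp
      · simp only [Fin.mk_one, Matrix.cons_val_one, Pi.add_apply, Pi.smul_apply, smul_eq_mul,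
          Matrix.cons_val_fin_one]
        rw [h]; ring
    have hs : a * z 0 + b * w 0 - T 0 = a * (z 0 - T 0) + b * (w 0 - T 0) := by
      linear_combination T 0 * hab
    have left : z 0 ≤ T 0 → w 0 ≤ T 0 →
        max (a * z 0 + b * w 0 - T 0) 0 = a * max (z 0 - T 0) 0 + b * max (w 0 - T 0) 0 := by
      intro h1 h2
      have e1 := mul_nonneg ha0 (sub_nonneg.2 h1)
      have e2 := mul_nonneg hb0 (sub_nonneg.2 h2)
      rw [max_eq_right (by linarith : z 0 - T 0 ≤ 0), max_eq_right (by linarith : w 0 - T 0 ≤ 0),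
        max_eq_right (by linarith)]
      simp
    have right : T 0 ≤ z 0 → T 0 ≤ w 0 →
        max (a * z 0 + b * w 0 - T 0) 0 = a * max (z 0 - T 0) 0 + b * max (w 0 - T 0) 0 := by
      intro h1 h2
      have e1 := mul_nonneg ha0 (sub_nonneg.2 h1)
      have e2 := mul_nonneg hb0 (sub_nonneg.2 h2)
      rw [max_eq_left (by linarith : 0 ≤ z 0 - T 0), max_eq_left (by linarith : 0 ≤ w 0 - T 0),
        max_eq_left (by linarith)]
      exact hs
    rcases lt_trichotomy (z 0) (T 0) with h1 | h1 | h1 <;>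
      rcases lt_trichotomy (w 0) (T 0) with h2 | h2 | h2
    · exact same (left h1.le h2.le)
    · exact same (left h1.le h2.le)
    · have := key z hz w hw h1 h2 a b ha0 hb0 hab
      rwa [max_eq_right (by linarith : z 0 - T 0 ≤ 0), max_eq_left (by linarith : 0 ≤ w 0 - T 0),
        mul_zero, add_zero]
    · exact same (left h1.le h2.le)
    · exact same (left h1.le h2.le)
    · exact same (right h1.ge h2.le)
    · have := key w hw z hz h2 h1 b a hb0 ha0 (by linarith)
      rw [max_eq_left (by linarith : 0 ≤ z 0 - T 0), max_eq_right (by linarith : w 0 - T 0 ≤ 0),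
        mul_zero, add_zero]
      convert this using 1
      rw [add_comm (a * z 0), add_comm (a * (z 1 + κ * (z 0 - T 0)))]
    · exact same (right h1.le h2.ge)
    · exact same (right h1.le h2.le)
  · ext k
    fin_cases k <;> simp

/-- If a linear functional `f` attains its maximum over points `0`, `l d`, `l d + l' d'`, `w` at
the midpoint of the segment from `0` to `l d`, and is smaller at some point `u`, and `d'` is to the
right of `d`, then `w` is weakly to the right of `d`. -/
theorem det_nonpos_of_functional {f0 f1 d0 d1 d0' d1' l l' u0 u1 w0 w1 : ℝ} (hl : 0 < l)
    (hl' : 0 < l') (hcw : d0 * d1' - d1 * d0' < 0)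
    (h0 : 0 ≤ l / 2 * (f0 * d0 + f1 * d1))
    (h1 : l * (f0 * d0 + f1 * d1) ≤ l / 2 * (f0 * d0 + f1 * d1))
    (h2 : l * (f0 * d0 + f1 * d1) + l' * (f0 * d0' + f1 * d1') ≤ l / 2 * (f0 * d0 + f1 * d1))
    (h3 : f0 * w0 + f1 * w1 ≤ l / 2 * (f0 * d0 + f1 * d1))
    (h4 : f0 * u0 + f1 * u1 < l / 2 * (f0 * d0 + f1 * d1)) :
    d0 * w1 - d1 * w0 ≤ 0 := by
  have hd : f0 * d0 + f1 * d1 = 0 := by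
    have : l / 2 * (f0 * d0 + f1 * d1) = 0 := by linarith
    rcases mul_eq_zero.1 this with h | h
    · linarith
    · exact h
  rw [hd] at h0 h1 h2 h3 h4
  have hn : 0 < d0 ^ 2 + d1 ^ 2 := by
    by_contra! h
    have e0 : d0 = 0 := by nlinarith [sq_nonneg d0, sq_nonneg d1]
    have e1 : d1 = 0 := by nlinarith [sq_nonneg d0, sq_nonneg d1]
    simp [e0, e1] at hcw
  have hid : ∀ a b : ℝ, (d0 ^ 2 + d1 ^ 2) * (f0 * a + f1 * b) =
      (d0 * b - d1 * a) * (f1 * d0 - f0 * d1) := by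
    intro a b
    linear_combination (d0 * a + d1 * b) * hd
  have h2' : f0 * d0' + f1 * d1' ≤ 0 := by
    by_contra! h
    have := mul_pos hl' h
    linarith
  have hJ : 0 < f1 * d0 - f0 * d1 := by
    have hge : 0 ≤ f1 * d0 - f0 * d1 := by
      by_contra! h
      have e1 := mul_pos_of_neg_of_neg hcw h
      have e2 := mul_nonpos_of_nonneg_of_nonpos hn.le h2'
      rw [hid] at e2
      linarith
    refine hge.lt_of_ne fun h => ?_
    have e1 := hid u0 u1
    rw [← h, mul_zero] at e1
    rcases mul_eq_zero.1 e1 with h' | h'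
    · exact hn.ne' h'
    · linarith
  by_contra! h
  have e1 := mul_pos h hJ
  rw [← hid] at e1
  have e2 := mul_nonpos_of_nonneg_of_nonpos hn.le (show f0 * w0 + f1 * w1 ≤ 0 by linarith)
  linarith

namespace STRep

variable {d m : ℕ}

theorem convex_carrier (R : STRep d m) : Convex ℝ R.carrier := convex_convexHull ℝ _

theorem isCompact_carrier (R : STRep d m) : IsCompact R.carrier :=
  (Set.finite_range R.V).isCompact_convexHull ℝ

theorem V_mem_carrier (R : STRep d m) (i : Fin d) : R.V i ∈ R.carrier :=
  subset_convexHull ℝ _ ⟨i, rfl⟩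

variable [NeZero d] {R : STRep d m}

theorem IsValid.edge_mem_carrier (hR : R.IsValid) (i : Fin d) {s : ℝ} (h0 : 0 ≤ s)
    (h1 : s ≤ R.len i) : (fun k => R.V i k + s * (R.dir i k : ℝ)) ∈ R.carrier := by
  have hl := hR.len_pos i
  have := R.convex_carrier (R.V_mem_carrier i) (R.V_mem_carrier (i + 1))
    (a := 1 - s / R.len i) (b := s / R.len i)
    (by rw [sub_nonneg, div_le_one hl]; exact h1) (by positivity) (by ring)
  convert this using 1
  ext k
  have h := hR.edge_eq i k
  simp only [Pi.add_apply, Pi.smul_apply, smul_eq_mul]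
  rw [show R.V (i + 1) k = R.V i k + R.len i * (R.dir i k : ℝ) by linarith]
  field_simp
  ring

/-- The polygon lies to the right of each of its (clockwise) edges. -/
theorem IsValid.det_nonpos (hR : R.IsValid) (hne : (interior R.carrier).Nonempty) (i : Fin d)
    {z : Pt} (hz : z ∈ R.carrier) :
    (R.dir i 0 : ℝ) * (z 1 - R.V i 1) - R.dir i 1 * (z 0 - R.V i 0) ≤ 0 := by
  have hl := hR.len_pos i
  have hl' := hR.len_pos (i + 1)
  have hcw : (R.dir i 0 : ℝ) * R.dir (i + 1) 1 - R.dir i 1 * R.dir (i + 1) 0 < 0 := by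
    exact_mod_cast hR.clockwise i
  set x : Pt := midpoint ℝ (R.V i) (R.V (i + 1)) with hx
  have hxi : x ∉ interior R.carrier :=
    (hR.edges_boundary i (midpoint_mem_segment (𝕜 := ℝ) (R.V i) (R.V (i + 1)))).2
  obtain ⟨f, hf⟩ := geometric_hahn_banach_open_point R.convex_carrier.interior isOpen_interior hxi
  have hfle : ∀ w ∈ R.carrier, f w ≤ f x := by
    intro w hw
    have hw' : w ∈ closure (interior R.carrier) := by
      rw [R.convex_carrier.closure_interior_eq_closure_of_nonempty_interior hne]
      exact subset_closure hw
    exact closure_minimal (fun a ha => (hf a ha).le) (isClosed_le f.continuous continuous_const) hw'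
  obtain ⟨f0, f1, hfe⟩ : ∃ f0 f1 : ℝ, ∀ w, f w = f0 * w 0 + f1 * w 1 := by
    refine ⟨f (Pi.single 0 1), f (Pi.single 1 1), fun w => ?_⟩
    conv_lhs => rw [show w = w 0 • Pi.single 0 1 + w 1 • Pi.single 1 1 by
      ext k; fin_cases k <;> simp]
    rw [map_add, map_smul, map_smul, smul_eq_mul, smul_eq_mul]
    ring
  have hmid : ∀ k, x k = R.V i k + R.len i / 2 * (R.dir i k : ℝ) := by
    intro k
    have h := hR.edge_eq i k
    rw [hx, midpoint_eq_smul_add]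
    simp only [Pi.smul_apply, Pi.add_apply, smul_eq_mul, invOf_eq_inv]
    linarith
  have h0 := hfle _ (R.V_mem_carrier i)
  have h1 := hfle _ (R.V_mem_carrier (i + 1))
  have h2 := hfle _ (R.V_mem_carrier (i + 1 + 1))
  have h3 := hfle z hz
  obtain ⟨o, ho⟩ := hne
  have h4 := hf o ho
  have E0 := hR.edge_eq i 0
  have E1 := hR.edge_eq i 1
  have E0' := hR.edge_eq (i + 1) 0
  have E1' := hR.edge_eq (i + 1) 1
  simp only [hfe, hmid] at h0 h1 h2 h3 h4
  refine det_nonpos_of_functional hl hl' hcw (f0 := f0) (f1 := f1)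
    (u0 := o 0 - R.V i 0) (u1 := o 1 - R.V i 1) ?_ ?_ ?_ ?_ ?_
  · linarith
  · rw [show R.V (i + 1) 0 = R.V i 0 + R.len i * R.dir i 0 by linarith,
      show R.V (i + 1) 1 = R.V i 1 + R.len i * R.dir i 1 by linarith] at h1
    linarith
  · rw [show R.V (i + 1 + 1) 0 = R.V i 0 + R.len i * R.dir i 0 + R.len (i + 1) * R.dir (i + 1) 0 by
        linarith, show R.V (i + 1 + 1) 1 =
          R.V i 1 + R.len i * R.dir i 1 + R.len (i + 1) * R.dir (i + 1) 1 by linarith] at h2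
    linarith
  · linarith
  · linarith

theorem IsValid.dir_ne_zero (hR : R.IsValid) (i : Fin d) :
    0 < (R.dir i 0 : ℝ) ^ 2 + (R.dir i 1 : ℝ) ^ 2 := by
  by_contra! h
  have h0 : (R.dir i 0 : ℝ) = 0 := by
    nlinarith [sq_nonneg (R.dir i 0 : ℝ), sq_nonneg (R.dir i 1 : ℝ)]
  have h1 : (R.dir i 1 : ℝ) = 0 := by
    nlinarith [sq_nonneg (R.dir i 0 : ℝ), sq_nonneg (R.dir i 1 : ℝ)]
  have := hR.primitive i
  rw [Int.cast_eq_zero.1 h0, Int.cast_eq_zero.1 h1] at this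
  simp at this

theorem IsValid.det_neg (hR : R.IsValid) (i : Fin d) {z : Pt} (hz : z ∈ interior R.carrier) :
    (R.dir i 0 : ℝ) * (z 1 - R.V i 1) - R.dir i 1 * (z 0 - R.V i 0) < 0 := by
  have hc : Continuous fun s : ℝ => (![z 0 - s * R.dir i 1, z 1 + s * R.dir i 0] : Pt) := by
    fun_prop
  have h0 : (fun s : ℝ => (![z 0 - s * R.dir i 1, z 1 + s * R.dir i 0] : Pt)) 0 = z := by
    ext k; fin_cases k <;> simp
  have hev : ∀ᶠ s : ℝ in nhdsWithin 0 (Ioi 0),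
      (![z 0 - s * R.dir i 1, z 1 + s * R.dir i 0] : Pt) ∈ R.carrier := by
    apply Filter.Eventually.filter_mono nhdsWithin_le_nhds
    apply hc.continuousAt.eventually
    rw [h0]
    exact mem_interior_iff_mem_nhds.1 hz
  obtain ⟨s, hs, hs0⟩ := (hev.and self_mem_nhdsWithin).exists
  have := hR.det_nonpos ⟨z, hz⟩ i hs
  simp only [Matrix.cons_val_zero, Matrix.cons_val_one, Matrix.cons_val_fin_one] at this
  nlinarith [mul_pos (show (0 : ℝ) < s from hs0) (hR.dir_ne_zero i)]

theorem IsValid.det_nonpos_pred (hR : R.IsValid) (hne : (interior R.carrier).Nonempty) (i : Fin d)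
    {z : Pt} (hz : z ∈ R.carrier) :
    (R.dir (i - 1) 0 : ℝ) * (z 1 - R.V i 1) - R.dir (i - 1) 1 * (z 0 - R.V i 0) ≤ 0 := by
  have h := hR.det_nonpos hne (i - 1) hz
  have h0 := hR.edge_eq (i - 1) 0
  have h1 := hR.edge_eq (i - 1) 1
  rw [sub_add_cancel] at h0 h1
  rw [show R.V i 0 = R.V (i - 1) 0 + R.len (i - 1) * R.dir (i - 1) 0 by linarith,
    show R.V i 1 = R.V (i - 1) 1 + R.len (i - 1) * R.dir (i - 1) 1 by linarith]
  linarith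

end STRep

namespace STRep

variable {d m : ℕ} [NeZero d] {R : STRep d m}

theorem detZ_u1_Tpow_u2 (R : STRep d m) (i : Fin d) (k : ℤ) :
    detZ (R.u1 i) ((Tpow k).mulVec (R.u2 i)) =
      R.dir (i - 1) 1 * R.dir i 0 - R.dir (i - 1) 0 * (k * R.dir i 0 + R.dir i 1) := by
  simp [detZ, u1, u2, Tpow, Matrix.mulVec, dotProduct, Fin.sum_univ_two]
  ring

theorem IsValid.exists_cutHits_vertex (hR : R.IsValid) (j : Fin m) :
    ∃ i, R.CutHits j (R.V i) ∧
      ∀ z ∈ R.carrier, z 0 = R.c j 0 → (R.eps j : ℝ) * z 1 ≤ R.eps j * R.V i 1 := by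
  have hcl : IsClosed {z : Pt | z 0 = R.c j 0} := isClosed_eq (by fun_prop) (by fun_prop)
  have hcj : R.c j ∈ R.carrier := interior_subset (hR.marked_interior j)
  obtain ⟨v, ⟨hv, hv0⟩, hmax⟩ := (R.isCompact_carrier.inter_right hcl).exists_isMaxOn
    ⟨R.c j, hcj, rfl⟩ (f := fun z : Pt => (R.eps j : ℝ) * z 1) (by fun_prop)
  have hmax' : ∀ z ∈ R.carrier, z 0 = R.c j 0 → (R.eps j : ℝ) * z 1 ≤ R.eps j * v 1 :=
    fun z hz hz0 => hmax ⟨hz, hz0⟩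
  have hκ : (R.eps j : ℝ) * R.eps j = 1 := by
    rcases hR.eps_pm j with h | h <;> rw [h] <;> norm_num
  have hfr : v ∈ frontier R.carrier := by
    refine ⟨subset_closure hv, fun hint => ?_⟩
    have hc : Continuous fun s : ℝ => (![v 0, v 1 + s * R.eps j] : Pt) := by fun_prop
    have h0 : (fun s : ℝ => (![v 0, v 1 + s * R.eps j] : Pt)) 0 = v := by
      ext k; fin_cases k <;> simp
    have hev : ∀ᶠ s : ℝ in nhdsWithin 0 (Ioi 0),
        (![v 0, v 1 + s * R.eps j] : Pt) ∈ R.carrier := by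
      apply Filter.Eventually.filter_mono nhdsWithin_le_nhds
      apply hc.continuousAt.eventually
      rw [h0]
      exact mem_interior_iff_mem_nhds.1 hint
    obtain ⟨s, hs, hs0⟩ := (hev.and self_mem_nhdsWithin).exists
    have h1 := hmax' _ hs (by simpa using hv0)
    simp only [Matrix.cons_val_one, Matrix.cons_val_fin_one] at h1
    have : (0 : ℝ) < s := hs0
    linarith [show (R.eps j : ℝ) * (v 1 + s * R.eps j) = R.eps j * v 1 + s by
      linear_combination s * hκ]
  have hhit : R.CutHits j v := ⟨hfr, hv0, by linarith [hmax' _ hcj rfl]⟩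
  obtain ⟨i, rfl⟩ := hR.cuts_at_vertices j v hhit
  exact ⟨i, hhit, hmax'⟩

/-- At the boundary point hit by a cut, the polygon is bounded by two lines whose slopes differ by
at least the number of cuts in the same direction on the same vertical line. -/
theorem IsValid.exists_slopes (hR : R.IsValid) (j : Fin m) :
    ∃ y AR AL : ℝ, (![R.c j 0, y] : Pt) ∈ R.carrier ∧
      AR + (Finset.univ.filter fun j' => R.c j' 0 = R.c j 0 ∧ R.eps j' = R.eps j).card ≤ AL ∧
      ∀ z ∈ R.carrier, (R.eps j : ℝ) * (z 1 - y) ≤ AR * (z 0 - R.c j 0) ∧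
        (R.eps j : ℝ) * (z 1 - y) ≤ AL * (z 0 - R.c j 0) := by
  obtain ⟨i, hhit, hmax⟩ := hR.exists_cutHits_vertex j
  have hint := hR.marked_interior j
  have hne : (interior R.carrier).Nonempty := ⟨_, hint⟩
  have hk : (Finset.univ.filter fun j' => R.c j' 0 = R.c j 0 ∧ R.eps j' = R.eps j).card ≤
      R.numCuts i := by
    rw [numCuts, ← Set.ncard_coe_finset]
    refine Set.ncard_le_ncard (fun j' hj' => ?_) (Set.toFinite _)
    simp only [Finset.coe_filter, Finset.mem_univ, true_and, Set.mem_ofPred_eq] at hj'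
    refine ⟨hhit.1, hhit.2.1.trans hj'.1.symm, ?_⟩
    rw [hj'.2]
    linarith [hmax _ (interior_subset (hR.marked_interior j')) hj'.1]
  have hkpos : 0 < R.numCuts i := by
    rw [numCuts, Set.ncard_pos (Set.toFinite _)]
    exact ⟨j, hhit⟩
  have hdet : 0 ≤ R.dir (i - 1) 1 * R.dir i 0 -
      R.dir (i - 1) 0 * (R.numCuts i * R.dir i 0 + R.dir i 1) := by
    rw [← detZ_u1_Tpow_u2]
    rcases hR.corner_cut i hkpos with h | h <;> rw [h]
    norm_num
  have hdet' : (0 : ℝ) ≤ R.dir (i - 1) 1 * R.dir i 0 -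
      R.dir (i - 1) 0 * (R.numCuts i * R.dir i 0 + R.dir i 1) := by exact_mod_cast hdet
  have hk' : ((Finset.univ.filter fun j' => R.c j' 0 = R.c j 0 ∧ R.eps j' = R.eps j).card : ℝ) ≤
      R.numCuts i := by exact_mod_cast hk
  have hpred : ∀ z : Pt, (R.dir (i - 1) 0 : ℝ) * (z 1 - R.V (i - 1) 1) -
      R.dir (i - 1) 1 * (z 0 - R.V (i - 1) 0) =
      (R.dir (i - 1) 0 : ℝ) * (z 1 - R.V i 1) - R.dir (i - 1) 1 * (z 0 - R.V i 0) := by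
    intro z
    have h0 := hR.edge_eq (i - 1) 0
    have h1 := hR.edge_eq (i - 1) 1
    rw [sub_add_cancel] at h0 h1
    linear_combination (R.dir (i - 1) 0 : ℝ) * h1 - (R.dir (i - 1) 1 : ℝ) * h0
  have hn := hR.det_neg i hint
  have hn' := hR.det_neg (i - 1) hint
  rw [hpred] at hn'
  have hD := fun z hz => hR.det_nonpos hne i (z := z) hz
  have hD' := fun z hz => hR.det_nonpos_pred hne i (z := z) hz
  have hx : R.V i 0 = R.c j 0 := hhit.2.1
  have hy := hhit.2.2
  have hmem : (![R.c j 0, R.V i 1] : Pt) ∈ R.carrier := by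
    convert R.V_mem_carrier i using 1
    ext k; fin_cases k <;> simp [hx]
  rw [hx, sub_self, mul_zero, sub_zero] at hn hn'
  rw [hx] at hD hD'
  generalize ((Finset.univ.filter fun j' => R.c j' 0 = R.c j 0 ∧ R.eps j' = R.eps j).card : ℝ) = N
    at hk' ⊢
  generalize (R.numCuts i : ℝ) = k at hdet' hk'
  rcases hR.eps_pm j with h | h
  · rw [h] at hy ⊢
    simp only [Int.cast_one, one_mul] at hy ⊢
    have hp : 0 < (R.dir i 0 : ℝ) := by by_contra! h; nlinarith
    have hp' : 0 < (R.dir (i - 1) 0 : ℝ) := by by_contra! h; nlinarith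
    refine ⟨R.V i 1, R.dir i 1 / R.dir i 0, R.dir (i - 1) 1 / R.dir (i - 1) 0, hmem, ?_,
      fun z hz => ⟨?_, ?_⟩⟩
    · have : R.dir i 1 / R.dir i 0 + k ≤ (R.dir (i - 1) 1 / R.dir (i - 1) 0 : ℝ) := by
        rw [div_add' _ _ _ hp.ne', div_le_div_iff₀ hp hp']
        linarith
      linarith
    · rw [div_mul_eq_mul_div, le_div_iff₀ hp]
      linarith [hD z hz]
    · rw [div_mul_eq_mul_div, le_div_iff₀ hp']
      linarith [hD' z hz]
  · rw [h] at hy ⊢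
    simp only [Int.cast_one, Int.cast_neg, neg_mul, one_mul] at hy ⊢
    have hp : 0 < -(R.dir i 0 : ℝ) := by by_contra! h; nlinarith
    have hp' : 0 < -(R.dir (i - 1) 0 : ℝ) := by by_contra! h; nlinarith
    refine ⟨R.V i 1, R.dir (i - 1) 1 / -R.dir (i - 1) 0, R.dir i 1 / -R.dir i 0, hmem, ?_,
      fun z hz => ⟨?_, ?_⟩⟩
    · have : R.dir (i - 1) 1 / -R.dir (i - 1) 0 + k ≤ (R.dir i 1 / -R.dir i 0 : ℝ) := by
        rw [div_add' _ _ _ hp'.ne', div_le_div_iff₀ hp' hp]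
        linarith
      linarith
    · rw [div_mul_eq_mul_div, le_div_iff₀ hp']
      linarith [hD' z hz]
    · rw [div_mul_eq_mul_div, le_div_iff₀ hp]
      linarith [hD z hz]

end STRep

/-- The height by which `stMap` translates the vertical line over `x`. -/
noncomputable def stHeight {m : ℕ} (c : Fin m → Pt) (n : ℤ) (t : ℝ) (u : Fin m → ℤ) (x : ℝ) : ℝ :=
  n * x + t + ∑ j, (u j : ℝ) * max (x - c j 0) 0

section stHeight

variable {m : ℕ} (c : Fin m → Pt) (n : ℤ) (t : ℝ) (u : Fin m → ℤ)

theorem stMap_apply_zero (x : Pt) : stMap c n t u x 0 = x 0 := rfl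

theorem stMap_apply_one (x : Pt) : stMap c n t u x 1 = x 1 + stHeight c n t u (x 0) := by
  simp only [stMap, stHeight, Matrix.cons_val_one, Matrix.cons_val_fin_one]
  ring

/-- The slope of `stHeight` to the right of `x`. -/
noncomputable def rightSlope (x : ℝ) : ℤ := n + ∑ j, if c j 0 ≤ x then u j else 0

/-- The slope of `stHeight` to the left of `x`. -/
noncomputable def leftSlope (x : ℝ) : ℤ := n + ∑ j, if c j 0 < x then u j else 0

theorem stHeight_right {x v : ℝ} (hv : 0 ≤ v) : ∀ᶠ s in nhdsWithin (0 : ℝ) (Ioi 0),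
    stHeight c n t u (x + s * v) = stHeight c n t u x + rightSlope c n u x * (s * v) := by
  have key : ∀ j, ∀ᶠ s in nhdsWithin (0 : ℝ) (Ioi 0), (u j : ℝ) * max (x + s * v - c j 0) 0 =
      u j * max (x - c j 0) 0 + ((if c j 0 ≤ x then u j else 0 : ℤ) : ℝ) * (s * v) := by
    intro j
    split_ifs with h
    · filter_upwards [self_mem_nhdsWithin] with s hs
      have := mul_nonneg (le_of_lt hs) hv
      rw [max_eq_left (by linarith), max_eq_left (by linarith)]
      ring
    · have hc : Continuous fun s : ℝ => x + s * v := by fun_prop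
      filter_upwards [(hc.continuousAt (x := 0)).eventually_lt continuousAt_const
        (by simpa using h : x + 0 * v < c j 0) |>.filter_mono nhdsWithin_le_nhds] with s hs
      rw [max_eq_right (by linarith), max_eq_right (by linarith)]
      simp
  filter_upwards [Filter.eventually_all.2 key] with s hs
  simp only [stHeight, rightSlope, hs, Finset.sum_add_distrib, ← Finset.sum_mul, Int.cast_add,
    Int.cast_sum]
  ring

theorem stHeight_left {x v : ℝ} (hv : v ≤ 0) : ∀ᶠ s in nhdsWithin (0 : ℝ) (Ioi 0),
    stHeight c n t u (x + s * v) = stHeight c n t u x + leftSlope c n u x * (s * v) := by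
  have key : ∀ j, ∀ᶠ s in nhdsWithin (0 : ℝ) (Ioi 0), (u j : ℝ) * max (x + s * v - c j 0) 0 =
      u j * max (x - c j 0) 0 + ((if c j 0 < x then u j else 0 : ℤ) : ℝ) * (s * v) := by
    intro j
    split_ifs with h
    · have hc : Continuous fun s : ℝ => x + s * v := by fun_prop
      filter_upwards [continuousAt_const.eventually_lt (hc.continuousAt (x := 0))
        (by simpa using h : c j 0 < x + 0 * v) |>.filter_mono nhdsWithin_le_nhds] with s hs
      rw [max_eq_left (by linarith), max_eq_left (by linarith)]
      ring
    · filter_upwards [self_mem_nhdsWithin] with s hs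
      have := mul_nonpos_of_nonneg_of_nonpos (le_of_lt hs) hv
      rw [max_eq_right (by linarith), max_eq_right (by linarith)]
      simp
  filter_upwards [Filter.eventually_all.2 key] with s hs
  simp only [stHeight, leftSlope, hs, Finset.sum_add_distrib, ← Finset.sum_mul, Int.cast_add,
    Int.cast_sum]
  ring

end stHeight

/-- Small positive multiples stay in a convex set. -/
theorem Convex.eventually_add_smul_mem {S : Set Pt} (hS : Convex ℝ S) {T z : Pt} (hT : T ∈ S)
    (hz : z ∈ S) : ∀ᶠ s in nhdsWithin (0 : ℝ) (Ioi 0), T + s • (z - T) ∈ S := by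
  have h1 : ∀ᶠ s in nhdsWithin (0 : ℝ) (Ioi 0), s < 1 :=
    (eventually_lt_nhds one_pos).filter_mono nhdsWithin_le_nhds
  filter_upwards [self_mem_nhdsWithin, h1] with s hs hs1
  exact hS.add_smul_sub_mem hT hz ⟨le_of_lt hs, hs1.le⟩

/-- The image of a semitoric polygon under an element of `𝒯 × G_m` is convex. -/
theorem STRep.IsValid.convex_stMap_image {d m : ℕ} [NeZero d] {R : STRep d m} (hR : R.IsValid)
    (n : ℤ) (t : ℝ) {u : Fin m → ℤ} (hu : ∀ j, u j = 0 ∨ u j = R.eps j) :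
    Convex ℝ (stMap R.c n t u '' R.carrier) := by
  suffices H : ∀ J : Finset (Fin m),
      Convex ℝ (stMap R.c n t (fun j => if j ∈ J then u j else 0) '' R.carrier) by
    simpa using H Finset.univ
  intro J
  induction J using Finset.induction_on with
  | empty =>
    rintro _ ⟨z, hz, rfl⟩ _ ⟨w, hw, rfl⟩ a b ha hb hab
    refine ⟨_, R.convex_carrier hz hw ha hb hab, ?_⟩
    ext k
    fin_cases k
    · simp [stMap]
    · simp only [stMap, Fin.mk_one, Matrix.cons_val_one, Matrix.cons_val_fin_one, Pi.add_apply,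
        Pi.smul_apply, smul_eq_mul]
      simp only [Finset.notMem_empty, if_false, Int.cast_zero, zero_mul, Finset.sum_const_zero]
      linear_combination (-t) * hab
  | insert j J hj ih =>
    rcases hu j with h0 | h0
    · convert ih using 3
      ext j'
      by_cases h : j' = j
      · subst h; simp [h0]
      · simp [h]
    set u' : Fin m → ℤ := fun j => if j ∈ J then u j else 0 with hu'
    obtain ⟨y, AR, AL, hmem, hcard, hbd⟩ := hR.exists_slopes j
    have hfun : stMap R.c n t (fun j' => if j' ∈ insert j J then u j' else 0) =
        (fun z : Pt => (![z 0, z 1 + (R.eps j : ℝ) *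
          max (z 0 - stMap R.c n t u' ![R.c j 0, y] 0) 0] : Pt)) ∘ stMap R.c n t u' := by
      ext x k
      fin_cases k
      · rfl
      · simp only [Fin.mk_one, Function.comp_apply, Matrix.cons_val_one, Matrix.cons_val_fin_one,
          stMap_apply_one, stMap_apply_zero, Matrix.cons_val_zero, stHeight]
        have : ∀ j', ((if j' ∈ insert j J then u j' else 0 : ℤ) : ℝ) * max (x 0 - R.c j' 0) 0 =
            (u' j' : ℝ) * max (x 0 - R.c j' 0) 0 +
              if j' = j then (R.eps j : ℝ) * max (x 0 - R.c j 0) 0 else 0 := by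
          intro j'
          by_cases h : j' = j
          · subst h; simp [hu', hj, h0]
          · simp [hu', h]
        simp only [this, Finset.sum_add_distrib, Finset.sum_ite_eq', Finset.mem_univ, if_true]
        ring
    rw [hfun, Set.image_comp]
    have hκ : (R.eps j : ℝ) = 1 ∨ (R.eps j : ℝ) = -1 := by exact_mod_cast hR.eps_pm j
    have hκ2 : (R.eps j : ℝ) * R.eps j = 1 := by rcases hκ with h | h <;> rw [h] <;> norm_num
    have hslope : R.eps j * (rightSlope R.c n u' (R.c j 0) - leftSlope R.c n u' (R.c j 0)) + 1 ≤
        (Finset.univ.filter fun j' => R.c j' 0 = R.c j 0 ∧ R.eps j' = R.eps j).card := by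
      have hsum : R.eps j * (rightSlope R.c n u' (R.c j 0) - leftSlope R.c n u' (R.c j 0)) + 1 =
          ∑ j', (R.eps j * ((if R.c j' 0 ≤ R.c j 0 then u' j' else 0) -
            if R.c j' 0 < R.c j 0 then u' j' else 0) + if j' = j then 1 else 0) := by
        simp [rightSlope, leftSlope, Finset.sum_add_distrib, Finset.mul_sum, mul_sub]
      rw [hsum, Finset.card_filter, Nat.cast_sum]
      refine Finset.sum_le_sum fun j' _ => ?_
      by_cases h : j' = j
      · subst h; simp [hu', hj]
      · rcases lt_trichotomy (R.c j' 0) (R.c j 0) with h1 | h1 | h1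
        · simp [h, h1, h1.le, h1.ne]
        · have h2 : R.eps j * u' j' ≤ if R.eps j' = R.eps j then 1 else 0 := by
            by_cases h3 : j' ∈ J
            · rcases hu j' with h4 | h4 <;> rcases hR.eps_pm j with h5 | h5 <;>
                rcases hR.eps_pm j' with h6 | h6 <;> simp [hu', h3, h4, h5, h6]
            · simp only [hu', h3, if_false, mul_zero]
              split_ifs <;> norm_num
          simpa [h, h1] using h2
        · simp [h, h1.not_ge, h1.not_gt, h1.ne']
    have hslope' : (R.eps j : ℝ) * (rightSlope R.c n u' (R.c j 0) - leftSlope R.c n u' (R.c j 0)) +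
        1 ≤ (Finset.univ.filter fun j' => R.c j' 0 = R.c j 0 ∧ R.eps j' = R.eps j).card := by
      exact_mod_cast hslope
    have hT := Set.mem_image_of_mem (stMap R.c n t u') hmem
    refine convex_image_shear (aR := AR + R.eps j * rightSlope R.c n u' (R.c j 0))
      (aL := AL + R.eps j * leftSlope R.c n u' (R.c j 0)) ih hT hκ (by linarith) ?_ ?_
    · intro z hz hz0
      simp only [stMap_apply_zero, stMap_apply_one, Matrix.cons_val_zero, Matrix.cons_val_one,
        Matrix.cons_val_fin_one] at hz0 ⊢
      obtain ⟨s, ⟨⟨w, hw, hws⟩, hs⟩, hs0⟩ := ((ih.eventually_add_smul_mem hT hz).and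
        (stHeight_right R.c n t u' (sub_nonneg.2 hz0))|>.and self_mem_nhdsWithin).exists
      have hs0 : 0 < s := hs0
      have e0 := congrFun hws 0
      have e1 := congrFun hws 1
      simp only [Pi.add_apply, Pi.smul_apply, Pi.sub_apply, smul_eq_mul, stMap_apply_zero,
        stMap_apply_one, Matrix.cons_val_zero, Matrix.cons_val_one, Matrix.cons_val_fin_one]
        at e0 e1
      rw [e0, hs] at e1
      have h1 := (hbd w hw).1
      rw [e0] at h1
      have h2 : w 1 = y + s * (z 1 - (y + stHeight R.c n t u' (R.c j 0))) -
          rightSlope R.c n u' (R.c j 0) * (s * (z 0 - R.c j 0)) := by linarith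
      rw [h2] at h1
      refine le_of_mul_le_mul_left ?_ hs0
      linarith
    · intro z hz hz0
      simp only [stMap_apply_zero, stMap_apply_one, Matrix.cons_val_zero, Matrix.cons_val_one,
        Matrix.cons_val_fin_one] at hz0 ⊢
      obtain ⟨s, ⟨⟨w, hw, hws⟩, hs⟩, hs0⟩ := ((ih.eventually_add_smul_mem hT hz).and
        (stHeight_left R.c n t u' (sub_nonpos.2 hz0))|>.and self_mem_nhdsWithin).exists
      have hs0 : 0 < s := hs0
      have e0 := congrFun hws 0
      have e1 := congrFun hws 1
      simp only [Pi.add_apply, Pi.smul_apply, Pi.sub_apply, smul_eq_mul, stMap_apply_zero,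
        stMap_apply_one, Matrix.cons_val_zero, Matrix.cons_val_one, Matrix.cons_val_fin_one]
        at e0 e1
      rw [e0, hs] at e1
      have h1 := (hbd w hw).2
      rw [e0] at h1
      have h2 : w 1 = y + s * (z 1 - (y + stHeight R.c n t u' (R.c j 0))) -
          leftSlope R.c n u' (R.c j 0) * (s * (z 0 - R.c j 0)) := by linarith
      rw [h2] at h1
      refine le_of_mul_le_mul_left ?_ hs0
      linarith

/-- `(e, f)` is a frame at `p` for the set `Δ` and the triangle `B` of size `lam`: after the
shear by `stHeight`, `Δ` is contained in the cone at `p` spanned by `e` and `f`, and `B` contains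
the triangle of size `lam` in this cone. -/
structure IsFrame {m : ℕ} (Δ B : Set Pt) (c : Fin m → Pt) (n : ℤ) (t : ℝ) (u : Fin m → ℤ) (p : Pt)
    (lam : ℝ) (e f : Fin 2 → ℤ) : Prop where
  cone : ∀ z ∈ Δ, ∃ α β : ℝ, 0 ≤ α ∧ 0 ≤ β ∧ z 0 - p 0 = α * e 0 + β * f 0 ∧
    z 1 + stHeight c n t u (z 0) - (p 1 + stHeight c n t u (p 0)) = α * e 1 + β * f 1
  triangle : ∀ α β : ℝ, 0 ≤ α → 0 ≤ β → α + β < lam → ∃ r ∈ B, r 0 = p 0 + α * e 0 + β * f 0 ∧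
    r 1 + stHeight c n t u (r 0) = p 1 + stHeight c n t u (p 0) + α * e 1 + β * f 1

theorem IsFrame.swap {m : ℕ} {Δ B : Set Pt} {c : Fin m → Pt} {n : ℤ} {t : ℝ} {u : Fin m → ℤ}
    {p : Pt} {lam : ℝ} {e f : Fin 2 → ℤ} (h : IsFrame Δ B c n t u p lam e f) :
    IsFrame Δ B c n t u p lam f e := by
  constructor
  · intro z hz
    obtain ⟨α, β, hα, hβ, h0, h1⟩ := h.cone z hz
    exact ⟨β, α, hβ, hα, by rw [h0]; ring, by rw [h1]; ring⟩
  · intro α β hα hβ hl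
    obtain ⟨r, hr, h0, h1⟩ := h.triangle β α hβ hα (by linarith)
    exact ⟨r, hr, by rw [h0]; ring, by rw [h1]; ring⟩

theorem IsSTPackedTriangle.exists_isFrame {d m : ℕ} [NeZero d] {R : STRep d m} (hR : R.IsValid)
    {p : Pt} {lam : ℝ} {B : Set Pt} (hB : IsSTPackedTriangle R p lam B) :
    ∃ (n : ℤ) (t : ℝ) (u : Fin m → ℤ) (e f : Fin 2 → ℤ), detZ e f = 1 ∧
      IsFrame R.carrier B R.c n t u p lam e f := by
  obtain ⟨hlam, hBΔ, -, n, t, u, hu, ⟨M, hM⟩, U, hU, hpU, hloc⟩ := hB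
  have hconv := hR.convex_stMap_image n t hu
  have hdet : detZ (fun k => M k 0) (fun k => M k 1) = 1 := by
    have := M.det_coe
    rw [Matrix.det_fin_two] at this
    rw [detZ]
    linarith
  have hsl : ∀ (x : Pt) k, sl2Apply M x k = x 0 * M k 0 + x 1 * M k 1 := by
    intro x k
    simp [sl2Apply, Matrix.mulVec, dotProduct, Fin.sum_univ_two]
    ring
  have htri : ∀ α β : ℝ, 0 ≤ α → 0 ≤ β → α + β < lam → ∃ r ∈ B, r 0 = p 0 + α * M 0 0 + β * M 0 1 ∧
      r 1 + stHeight R.c n t u (r 0) = p 1 + stHeight R.c n t u (p 0) + α * M 1 0 + β * M 1 1 := by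
    intro α β hα hβ hl
    have hx : (![α, β] : Pt) ∈ modelTriangle lam := ⟨hα, hβ, hl⟩
    have hmem := Set.mem_image_of_mem (fun x => sl2Apply M x + stMap R.c n t u p) hx
    rw [← hM] at hmem
    obtain ⟨r, hr, hre⟩ := hmem
    have e0 := congrFun hre 0
    have e1 := congrFun hre 1
    simp only [Pi.add_apply, hsl, stMap_apply_zero, stMap_apply_one, Matrix.cons_val_zero,
      Matrix.cons_val_one, Matrix.cons_val_fin_one] at e0 e1
    exact ⟨r, hr, by linarith, by linarith⟩
  have hpB : p ∈ B := by
    obtain ⟨r, hr, h0, h1⟩ := htri 0 0 le_rfl le_rfl (by simpa using hlam)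
    simp only [zero_mul, add_zero] at h0 h1
    rw [h0] at h1
    convert hr using 1
    ext k
    fin_cases k
    · exact h0.symm
    · exact (add_right_cancel h1).symm
  refine ⟨n, t, u, _, _, hdet, ⟨fun z hz => ?_, htri⟩⟩
  have hT := Set.mem_image_of_mem (stMap R.c n t u) (hBΔ hpB)
  have hZ := Set.mem_image_of_mem (stMap R.c n t u) hz
  have hc : Continuous fun s : ℝ =>
      stMap R.c n t u p + s • (stMap R.c n t u z - stMap R.c n t u p) := by fun_prop
  have hUev : ∀ᶠ s in nhdsWithin (0 : ℝ) (Ioi 0),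
      stMap R.c n t u p + s • (stMap R.c n t u z - stMap R.c n t u p) ∈ U := by
    apply Filter.Eventually.filter_mono nhdsWithin_le_nhds
    apply hc.continuousAt.eventually
    simpa using hU.mem_nhds hpU
  obtain ⟨s, ⟨hsS, hsU⟩, hs⟩ := ((hconv.eventually_add_smul_mem hT hZ).and hUev |>.and
    self_mem_nhdsWithin).exists
  have hs : 0 < s := hs
  have hmem := Set.mem_inter hsS hsU
  rw [← hloc] at hmem
  have hmem := hmem.1
  rw [hM] at hmem
  obtain ⟨x, ⟨hx0, hx1, -⟩, hx⟩ := hmem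
  have e0 := congrFun hx 0
  have e1 := congrFun hx 1
  simp only [Pi.add_apply, Pi.smul_apply, Pi.sub_apply, smul_eq_mul, hsl, stMap_apply_zero,
    stMap_apply_one] at e0 e1
  refine ⟨x 0 / s, x 1 / s, by positivity, by positivity, ?_, ?_⟩
  · field_simp
    linarith
  · field_simp
    linarith

/-- A primitive vector `d` along an edge of `Δ` at `p` has the same horizontal component as the
vector of the frame lying on the same side. -/
theorem IsFrame.horizontal_eq {m : ℕ} {Δ B : Set Pt} {c : Fin m → Pt} {n : ℤ} {t : ℝ}
    {u : Fin m → ℤ} {p : Pt} {lam : ℝ} {e f : Fin 2 → ℤ} (h : IsFrame Δ B c n t u p lam e f)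
    (hBΔ : B ⊆ Δ) (hlam : 0 < lam) {κ : ℤ} (hκ : κ = 1 ∨ κ = -1) (hdet : detZ e f = κ)
    {d : Fin 2 → ℤ} (hd : Int.gcd (d 0) (d 1) = 1) {L : ℝ} (hL : 0 < L)
    (hedge : ∀ s : ℝ, 0 ≤ s → s ≤ L → (fun k => p k + s * (d k : ℝ)) ∈ Δ)
    (hside : ∀ z ∈ Δ, (κ : ℝ) * (d 0 * (z 1 - p 1) - d 1 * (z 0 - p 0)) ≤ 0) : f 0 = d 0 := by
  have hκ2 : κ * κ = 1 := by rcases hκ with h | h <;> rw [h] <;> norm_num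
  obtain ⟨N, K, hK, hev⟩ : ∃ N K : ℤ, 0 ≤ K ∧ ∀ᶠ s in nhdsWithin (0 : ℝ) (Ioi 0),
      stHeight c n t u (p 0 + s * d 0) = stHeight c n t u (p 0) + N * (s * d 0) ∧
      stHeight c n t u (p 0 + s * (K * d 0 + f 0 : ℤ)) =
        stHeight c n t u (p 0) + N * (s * (K * d 0 + f 0 : ℤ)) := by
    have hf := neg_abs_le (f 0)
    have hf' := le_abs_self (f 0)
    have hf'' := abs_nonneg (f 0)
    rcases lt_trichotomy (d 0) 0 with hd0 | hd0 | hd0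
    · refine ⟨leftSlope c n u (p 0), |f 0|, hf'', ?_⟩
      have h1 : |f 0| * d 0 + f 0 ≤ 0 := by nlinarith
      exact (stHeight_left c n t u (by exact_mod_cast hd0.le)).and
        (stHeight_left c n t u (by exact_mod_cast h1))
    · rcases le_total 0 (f 0) with h0 | h0
      · refine ⟨rightSlope c n u (p 0), 0, le_rfl, ?_⟩
        exact (stHeight_right c n t u (by exact_mod_cast hd0.ge)).and
          (stHeight_right c n t u (by simpa using h0))
      · refine ⟨leftSlope c n u (p 0), 0, le_rfl, ?_⟩
        exact (stHeight_left c n t u (by exact_mod_cast hd0.le)).and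
          (stHeight_left c n t u (by simpa using h0))
    · refine ⟨rightSlope c n u (p 0), |f 0|, hf'', ?_⟩
      have h1 : 0 ≤ |f 0| * d 0 + f 0 := by nlinarith
      exact (stHeight_right c n t u (by exact_mod_cast hd0.le)).and
        (stHeight_right c n t u (by exact_mod_cast h1))
  -- coordinates of the sheared edge direction in the frame
  obtain ⟨D, hD⟩ : ∃ D, D = d 1 + N * d 0 := ⟨_, rfl⟩
  obtain ⟨a, ha⟩ : ∃ a, a = κ * (d 0 * f 1 - D * f 0) := ⟨_, rfl⟩
  obtain ⟨b, hb⟩ : ∃ b, b = κ * (e 0 * D - e 1 * d 0) := ⟨_, rfl⟩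
  rw [detZ] at hdet
  have hd0 : d 0 = a * e 0 + b * f 0 := by
    rw [ha, hb]
    linear_combination (-d 0) * hκ2 - κ * d 0 * hdet
  have hD0 : D = a * e 1 + b * f 1 := by
    rw [ha, hb]
    linear_combination (-D) * hκ2 - κ * D * hdet
  have hdetR : (e 0 * f 1 - e 1 * f 0 : ℝ) = κ := by exact_mod_cast hdet
  have hκ2R : (κ * κ : ℝ) = 1 := by exact_mod_cast hκ2
  have haR : (a : ℝ) = κ * (d 0 * f 1 - D * f 0) := by exact_mod_cast ha
  have hbR : (b : ℝ) = κ * (e 0 * D - e 1 * d 0) := by exact_mod_cast hb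
  have hDR : (D : ℝ) = d 1 + N * d 0 := by exact_mod_cast hD
  have hd0R : (d 0 : ℝ) = a * e 0 + b * f 0 := by exact_mod_cast hd0
  have hD0R : (D : ℝ) = a * e 1 + b * f 1 := by exact_mod_cast hD0
  have hsmall : ∀ r : ℝ, ∀ x : ℝ, 0 < r → ∀ᶠ s in nhdsWithin (0 : ℝ) (Ioi 0), s * x < r := by
    intro r x hr
    have hc : Continuous fun s : ℝ => s * x := by fun_prop
    exact ((hc.continuousAt (x := 0)).eventually_lt continuousAt_const
      (by simpa using hr)).filter_mono nhdsWithin_le_nhds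
  obtain ⟨s, ⟨⟨⟨hs1, hs2⟩, hsL⟩, hsl⟩, hs⟩ := (((hev.and (hsmall L 1 hL)).and
    (hsmall lam (K * a + (K * b + 1)) hlam)).and self_mem_nhdsWithin).exists
  have hs : 0 < s := hs
  have hab : 0 ≤ a ∧ 0 ≤ b := by
    obtain ⟨α, β, hα, hβ, h0, h1⟩ := h.cone _ (hedge s hs.le (by linarith))
    rw [hs1] at h1
    have h0' : s * d 0 = α * e 0 + β * f 0 := by linarith
    have h1' : s * D = α * e 1 + β * f 1 := by rw [hDR]; linarith
    have hα' : s * a = α := by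
      rw [haR]
      linear_combination κ * f 1 * h0' - κ * f 0 * h1' + α * κ * hdetR + α * hκ2R
    have hβ' : s * b = β := by
      rw [hbR]
      linear_combination κ * e 0 * h1' - κ * e 1 * h0' + β * κ * hdetR + β * hκ2R
    constructor
    · have : (0 : ℝ) ≤ a := nonneg_of_mul_nonneg_right (by linarith) hs
      exact_mod_cast this
    · have : (0 : ℝ) ≤ b := nonneg_of_mul_nonneg_right (by linarith) hs
      exact_mod_cast this
  have haR0 : (0 : ℝ) ≤ a := by exact_mod_cast hab.1
  have hbR0 : (0 : ℝ) ≤ b := by exact_mod_cast hab.2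
  have hKR : (0 : ℝ) ≤ K := by exact_mod_cast hK
  have ha0 : a = 0 := by
    obtain ⟨r, hr, h0, h1⟩ := h.triangle (s * (K * a)) (s * (K * b + 1)) (by positivity)
      (by positivity) (by linarith)
    have h0' : r 0 = p 0 + s * (K * d 0 + f 0 : ℤ) := by
      push_cast
      rw [h0]
      linear_combination (-s * K) * hd0R
    rw [h0', hs2] at h1
    push_cast at h1 h0'
    have h2 := hside r (hBΔ hr)
    have h3 : (κ : ℝ) * (d 0 * (r 1 - p 1) - d 1 * (r 0 - p 0)) = s * a := by
      rw [haR, h0']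
      have h4 : r 1 - p 1 = s * (K * D + f 1) - N * (s * (K * d 0 + f 0)) := by
        rw [hD0R]; linarith
      rw [h4, hDR]
      ring
    rw [h3] at h2
    have h5 : (a : ℝ) ≤ 0 := by
      by_contra! h6
      linarith [mul_pos hs h6]
    exact le_antisymm (by exact_mod_cast h5) hab.1
  rw [ha0] at hd0 hD0
  have hb1 : b ∣ 1 := by
    rw [← Int.isCoprime_iff_gcd_eq_one] at hd
    obtain ⟨x, y, hxy⟩ := hd
    refine ⟨x * f 0 + y * (f 1 - N * f 0), ?_⟩
    have : d 1 = b * f 1 - N * (b * f 0) := by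
      rw [show d 1 = D - N * d 0 by rw [hD]; ring, hD0, hd0]; ring
    rw [this, hd0] at hxy
    linear_combination -hxy
  have hb1 : b = 1 := Int.eq_one_of_dvd_one hab.2 hb1
  rw [hd0, hb1]
  ring

/-- The bound on the size of a triangle in terms of a marked point `c₀` over or under a boundary
point `q` whose horizontal distance from the corner is that of the point at distance `τ` on the
side `f` of the triangle. -/
theorem IsFrame.le_of_notMem {m : ℕ} {Δ B : Set Pt} {c : Fin m → Pt} {n : ℤ} {t : ℝ}
    {u : Fin m → ℤ} {p : Pt} {lam : ℝ} {e f : Fin 2 → ℤ} (h : IsFrame Δ B c n t u p lam e f)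
    (hBΔ : B ⊆ Δ) {κ : ℤ} (hκ : κ = 1 ∨ κ = -1) (hdet : detZ e f = κ)
    {q c₀ : Pt} (hq : q ∈ Δ) (hc₀ : c₀ ∈ Δ) (hcB : c₀ ∉ B) (hqc : q 0 = c₀ 0) {τ : ℝ} (hτ : 0 ≤ τ)
    (hqp : q 0 = p 0 + τ * f 0) (hf : f 0 ≠ 0) {d1 : ℝ}
    (hside : ∀ z ∈ Δ, (κ : ℝ) * (f 0 * (z 1 - q 1) - d1 * (z 0 - q 0)) ≤ 0) :
    lam ≤ τ + |q 1 - c₀ 1| * |((f 0 - e 0 : ℤ) : ℝ)| := by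
  by_contra! hlt
  have hκ2 : (κ * κ : ℝ) = 1 := by rcases hκ with h | h <;> rw [h] <;> norm_num
  have hdetR : (e 0 * f 1 - e 1 * f 0 : ℝ) = κ := by exact_mod_cast hdet
  have hf' : (f 0 : ℝ) ≠ 0 := by exact_mod_cast hf
  have habs : 0 ≤ |q 1 - c₀ 1| * |((f 0 - e 0 : ℤ) : ℝ)| := by positivity
  -- `q` lies on the side `f`
  obtain ⟨r, hrB, hr0, hr1⟩ := h.triangle 0 τ le_rfl hτ (by linarith)
  have hrq : r 0 = q 0 := by rw [hr0, hqp]; ring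
  have h1 := hside r (hBΔ hrB)
  rw [hrq, sub_self, mul_zero, sub_zero] at h1
  obtain ⟨α, β, hα, hβ, hq0, hq1⟩ := h.cone q hq
  have hq0' : τ * f 0 = α * e 0 + β * f 0 := by linarith
  rw [hrq] at hr1
  have hq1' : q 1 - r 1 + τ * f 1 = α * e 1 + β * f 1 := by linarith
  have hα' : α = κ * (f 0 * (r 1 - q 1)) := by
    linear_combination (-κ * f 1) * hq0' + κ * f 0 * hq1' - α * κ * hdetR - α * hκ2
  have hrq1 : r 1 = q 1 := by
    have h3 : (κ : ℝ) * (f 0 * (r 1 - q 1)) = 0 := le_antisymm h1 (by linarith)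
    have hκ0 : (κ : ℝ) ≠ 0 := by rcases hκ with h | h <;> rw [h] <;> norm_num
    rcases mul_eq_zero.1 h3 with h4 | h4
    · exact absurd h4 hκ0
    · rcases mul_eq_zero.1 h4 with h5 | h5
      · exact absurd h5 hf'
      · linarith
  rw [hrq1] at hr1
  obtain ⟨α, β, hα, hβ, hc0, hc1⟩ := h.cone c₀ hc₀
  rw [← hqc] at hc0 hc1
  have hc0' : τ * f 0 = α * e 0 + β * f 0 := by linarith
  have hc1' : c₀ 1 - q 1 + τ * f 1 = α * e 1 + β * f 1 := by linarith
  have hα' : α = κ * (f 0 * (q 1 - c₀ 1)) := by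
    linear_combination (-κ * f 1) * hc0' + κ * f 0 * hc1' - α * κ * hdetR - α * hκ2
  have hβ' : β = τ - κ * (e 0 * (q 1 - c₀ 1)) := by
    linear_combination (-κ * e 0) * hc1' + κ * e 1 * hc0' - β * κ * hdetR - β * hκ2 +
      τ * κ * hdetR + τ * hκ2
  have hle : κ * ((q 1 - c₀ 1) * (f 0 - e 0)) ≤ |q 1 - c₀ 1| * |((f 0 - e 0 : ℤ) : ℝ)| := by
    rw [← abs_mul]
    push_cast
    rcases hκ with h | h <;> rw [h]
    · simpa using le_abs_self ((q 1 - c₀ 1) * ((f 0 : ℝ) - e 0))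
    · simpa using neg_le_abs ((q 1 - c₀ 1) * ((f 0 : ℝ) - e 0))
  obtain ⟨r', hr'B, hr'0, hr'1⟩ := h.triangle α β hα hβ (by
    rw [hα', hβ']
    linarith)
  apply hcB
  have e0 : r' 0 = q 0 := by linarith
  rw [e0] at hr'1
  have hrc : r' = c₀ := by
    ext k
    fin_cases k
    · exact e0.trans hqc
    · simp only [Fin.mk_one]
      linarith
  exact hrc ▸ hr'B

/-- The vertex reached from `s` after `K` steps forwards. -/
def stepCyc {d : ℕ} [NeZero d] (s : Fin d) (K : ℕ) : Fin d := Fin.ofNat d (s.val + K)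

section Cyclic

variable {d : ℕ}

theorem distCyc_of_le {s i : Fin d} (h : s.val ≤ i.val) : distCyc s i = i.val - s.val := by
  have hi := i.isLt
  rw [distCyc, show i.val + d - s.val = (i.val - s.val) + d by omega, Nat.add_mod_right,
    Nat.mod_eq_of_lt (by omega)]

theorem distCyc_of_lt {s i : Fin d} (h : i.val < s.val) :
    distCyc s i = i.val + d - s.val := by
  have hs := s.isLt
  rw [distCyc, Nat.mod_eq_of_lt (by omega)]

theorem distCyc_lt (s i : Fin d) : distCyc s i < d :=
  Nat.mod_lt _ (Nat.zero_lt_of_lt s.isLt)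

theorem distCyc_self (s : Fin d) : distCyc s s = 0 := by
  rw [distCyc_of_le le_rfl, Nat.sub_self]

theorem chainLen_le (s e : Fin d) : chainLen s e ≤ d := by
  unfold chainLen
  split_ifs
  exacts [le_rfl, (distCyc_lt s e).le]

variable [NeZero d]

theorem stepCyc_zero (s : Fin d) : stepCyc s 0 = s := by
  ext
  simp [stepCyc]

theorem stepCyc_succ (s : Fin d) (K : ℕ) : stepCyc s (K + 1) = stepCyc s K + 1 := by
  ext
  simp [stepCyc, Fin.val_add, ← add_assoc]

theorem stepCyc_distCyc (s i : Fin d) : stepCyc s (distCyc s i) = i := by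
  ext
  have hs := s.isLt
  have hi := i.isLt
  simp only [stepCyc, Fin.val_ofNat]
  rcases le_or_gt s.val i.val with h | h
  · rw [distCyc_of_le h, show s.val + (i.val - s.val) = i.val by omega, Nat.mod_eq_of_lt hi]
  · rw [distCyc_of_lt h, show s.val + (i.val + d - s.val) = i.val + d by omega,
      Nat.add_mod_right, Nat.mod_eq_of_lt hi]

theorem distCyc_stepCyc (s : Fin d) {K : ℕ} (hK : K < d) : distCyc s (stepCyc s K) = K := by
  have hs := s.isLt
  have hv : (stepCyc s K).val = (s.val + K) % d := by simp [stepCyc]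
  rcases lt_or_ge (s.val + K) d with h | h
  · rw [Nat.mod_eq_of_lt h] at hv
    rw [distCyc_of_le (by omega)]
    omega
  · rw [Nat.mod_eq_sub_mod h, Nat.mod_eq_of_lt (by omega)] at hv
    rw [distCyc_of_lt (by omega)]
    omega

theorem stepCyc_chainLen (s e : Fin d) : stepCyc s (chainLen s e) = e := by
  unfold chainLen
  split_ifs with h
  · ext
    simp [stepCyc, h, Nat.mod_eq_of_lt s.isLt]
  · exact stepCyc_distCyc s e

theorem sum_distCyc_lt_succ (f : Fin d → ℝ) (s : Fin d) {K : ℕ} (hK : K < d) :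
    (∑ i, if distCyc s i < K + 1 then f i else 0) =
      (∑ i, if distCyc s i < K then f i else 0) + f (stepCyc s K) := by
  have : f (stepCyc s K) = ∑ i, if i = stepCyc s K then f i else 0 := by simp
  rw [this, ← Finset.sum_add_distrib]
  refine Finset.sum_congr rfl fun i _ => ?_
  have hi : i = stepCyc s K ↔ distCyc s i = K :=
    ⟨fun h => h ▸ distCyc_stepCyc s hK, fun h => h ▸ (stepCyc_distCyc s i).symm⟩
  simp only [hi]
  split_ifs <;> first | omega | simp

theorem StrictMono.not_exists_eq_stepCyc {D : ℕ} [NeZero D] {g : Fin D → Fin d}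
    (hg : StrictMono g) (b : Fin D) {K : ℕ} (hK : 0 < K)
    (hKn : K < chainLen (g b) (g (b + 1))) : ¬ ∃ c, g c = stepCyc (g b) K := by
  rintro ⟨c, hc⟩
  have hdist : distCyc (g b) (g c) = K := by
    rw [hc, distCyc_stepCyc _ (hKn.trans_le (chainLen_le _ _))]
  have hcb : c ≠ b := by
    rintro rfl
    rw [distCyc_self] at hdist
    omega
  have hlt : ∀ {x y : Fin D}, x.val < y.val → (g x).val < (g y).val := fun h => hg h
  have hle : ∀ {x y : Fin D}, x.val ≤ y.val → (g x).val ≤ (g y).val := fun h => hg.monotone h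
  have hbD := b.isLt
  have hcD := c.isLt
  have hcb' : c.val ≠ b.val := fun h => hcb (Fin.ext h)
  have hb1 : (b + 1).val = (b.val + 1) % D := by
    simp [Fin.val_add]
  have hne : g (b + 1) ≠ g b := by
    intro h
    have := congrArg Fin.val (hg.injective h)
    rcases lt_or_ge (b.val + 1) D with h' | h'
    · rw [hb1, Nat.mod_eq_of_lt h'] at this
      omega
    · rw [hb1, show b.val + 1 = D by omega, Nat.mod_self] at this
      omega
  rw [chainLen, if_neg hne, ← hdist] at hKn
  have hgb := (g b).isLt
  have hgb1 := (g (b + 1)).isLt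
  rcases lt_or_ge (b.val + 1) D with h' | h'
  · rw [Nat.mod_eq_of_lt h'] at hb1
    have h1 := hlt (show b.val < (b + 1).val by omega)
    rw [distCyc_of_le h1.le] at hKn
    rcases lt_or_gt_of_ne hcb' with h | h
    · rw [distCyc_of_lt (hlt h)] at hKn
      omega
    · have h2 := hle (show (b + 1).val ≤ c.val by omega)
      rw [distCyc_of_le (hlt h).le] at hKn
      omega
  · rw [show b.val + 1 = D by omega, Nat.mod_self] at hb1
    have h1 := hlt (show (b + 1).val < b.val by omega)
    have h2 := hle (show (b + 1).val ≤ c.val by omega)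
    rw [distCyc_of_lt h1, distCyc_of_lt (hlt (show c.val < b.val by omega))] at hKn
    omega

end Cyclic

namespace STRep

variable {d m : ℕ} [NeZero d] {R : STRep d m}

theorem IsValid.dir_zero_eq_of_isFakeCorner (hR : R.IsValid) {i : Fin d}
    (h : R.IsFakeCorner i) : R.dir i 0 = R.dir (i - 1) 0 := by
  obtain ⟨-, h⟩ := h
  rw [detZ_u1_Tpow_u2] at h
  have hcw := hR.clockwise (i - 1)
  rw [sub_add_cancel, detZ] at hcw
  have h1 := hR.primitive (i - 1)
  have h2 := hR.primitive i
  generalize R.dir (i - 1) 0 = a at *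
  generalize R.dir (i - 1) 1 = b at *
  generalize R.dir i 0 = x at *
  generalize R.dir i 1 = y at *
  have h2' : IsCoprime x ((R.numCuts i : ℤ) * x + y) := by
    rw [add_comm]
    exact (Int.isCoprime_iff_gcd_eq_one.2 h2).add_mul_right_right _
  have hxa : x ∣ a := h2'.dvd_of_dvd_mul_right ⟨b, by linarith⟩
  have hax : a ∣ x := (Int.isCoprime_iff_gcd_eq_one.2 h1).dvd_of_dvd_mul_left
    ⟨(R.numCuts i : ℤ) * x + y, by linarith⟩
  rcases Int.natAbs_eq_natAbs_iff.1 (Nat.dvd_antisymm (Int.natAbs_dvd_natAbs.2 hxa)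
    (Int.natAbs_dvd_natAbs.2 hax)) with e | e
  · exact e
  · subst e
    have : 0 ≤ (R.numCuts i : ℤ) * (a * a) :=
      mul_nonneg (Int.natCast_nonneg _) (mul_self_nonneg a)
    nlinarith

/-- Along a chain of edges joined at fake corners the horizontal coordinate is proportional to
the `SL₂(ℤ)`-length. -/
theorem IsValid.chain (hR : R.IsValid) (s : Fin d) {n : ℕ} (hn : n ≤ d)
    (hfake : ∀ K, 0 < K → K < n → R.IsFakeCorner (stepCyc s K)) :
    (∀ K < n, R.dir (stepCyc s K) 0 = R.dir s 0) ∧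
    ∀ K ≤ n, R.V (stepCyc s K) 0 =
      R.V s 0 + R.dir s 0 * ∑ i, if distCyc s i < K then R.len i else 0 := by
  have hdir : ∀ K < n, R.dir (stepCyc s K) 0 = R.dir s 0 := by
    intro K
    induction K with
    | zero => exact fun _ => by rw [stepCyc_zero]
    | succ K ih =>
      intro hK
      rw [hR.dir_zero_eq_of_isFakeCorner (hfake _ K.succ_pos hK), ← ih (by omega), stepCyc_succ,
        add_sub_cancel_right]
  refine ⟨hdir, fun K => ?_⟩
  induction K with
  | zero => exact fun _ => by simp [stepCyc_zero]
  | succ K ih =>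
    intro hK
    have h := hR.edge_eq (stepCyc s K) 0
    rw [hdir K (by omega), ih (by omega)] at h
    rw [stepCyc_succ, sum_distCyc_lt_succ _ _ (by omega)]
    linear_combination h

theorem IsValid.chain_corners (hR : R.IsValid) {D : ℕ} [NeZero D] {g : Fin D → Fin d}
    (hg : IsCornerEnum R g) (b : Fin D) :
    (∀ K < chainLen (g b) (g (b + 1)), R.dir (stepCyc (g b) K) 0 = R.dir (g b) 0) ∧
    ∀ K ≤ chainLen (g b) (g (b + 1)), R.V (stepCyc (g b) K) 0 = R.V (g b) 0 +
      R.dir (g b) 0 * ∑ i, if distCyc (g b) i < K then R.len i else 0 := by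
  refine hR.chain (g b) (chainLen_le _ _) fun K hK hKn => ?_
  by_contra h
  exact hg.1.not_exists_eq_stepCyc b hK hKn ((hg.2 _).1 h)

end STRep

namespace STRep.IsValid

variable {d m : ℕ} [NeZero d] {R : STRep d m}

/-- The horizontal components of a frame at a vertex are those of the edges at this vertex. -/
theorem isFrame_horizontal_eq (hR : R.IsValid) (hne : (interior R.carrier).Nonempty) (v : Fin d)
    {B : Set Pt} {n : ℤ} {t : ℝ} {u : Fin m → ℤ} {lam : ℝ} {e f : Fin 2 → ℤ}
    (h : IsFrame R.carrier B R.c n t u (R.V v) lam e f) (hB : B ⊆ R.carrier) (hlam : 0 < lam)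
    (hdet : detZ e f = 1) : f 0 = R.dir v 0 ∧ e 0 = -R.dir (v - 1) 0 := by
  constructor
  · refine h.horizontal_eq hB hlam (Or.inl rfl) hdet (hR.primitive v) (hR.len_pos v)
      (fun s => hR.edge_mem_carrier v) fun z hz => ?_
    rw [Int.cast_one, one_mul]
    exact hR.det_nonpos hne v hz
  · refine h.swap.horizontal_eq (d := fun k => -R.dir (v - 1) k) hB hlam (Or.inr rfl) ?_ ?_
      (hR.len_pos (v - 1)) (fun s hs hs' => ?_) fun z hz => ?_
    · rw [detZ] at hdet ⊢
      linarith
    · simpa using hR.primitive (v - 1)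
    · convert hR.edge_mem_carrier (v - 1) (s := R.len (v - 1) - s) (by linarith) (by linarith)
        using 1
      ext k
      have := hR.edge_eq (v - 1) k
      rw [sub_add_cancel] at this
      push_cast
      linear_combination this
    · have := hR.det_nonpos_pred hne v hz
      push_cast
      linarith

theorem dir_zero_ne_zero (hR : R.IsValid) {i : Fin d} {j : Fin m} {s : ℝ} {q : Pt}
    (hqi : ∀ k, q k = R.V i k + s * (R.dir i k : ℝ)) (hqc : q 0 = R.c j 0) : R.dir i 0 ≠ 0 := by
  intro h
  have hn := hR.det_neg i (hR.marked_interior j)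
  have h0 := hqi 0
  rw [h] at hn h0
  have : R.c j 0 - R.V i 0 = 0 := by
    rw [← hqc, h0]
    simp
  rw [this] at hn
  simp at hn

end STRep.IsValid

/-- If `P` is a semitoric packing of the representative `R` with `λ_a`
the `SL₂(ℤ)`-size of the triangle packed at the hidden/Delzant corner `V (g a)` (`0` if
none), then `λ_a ≤ α_a` for all `a`, where `α_a` is the marked-point bound at
`V (g a)`. -/
theorem stmt12 {d m D : ℕ} [NeZero d] [NeZero D] (R : STRep d m) (hR : R.IsValid)
    (g : Fin D → Fin d) (hg : IsCornerEnum R g)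
    (sz : Fin D → ℝ) (P : Set Pt) (hP : IsSTPacking R g sz P) :
    ∀ a : Fin D, AlphaBound R g a (sz a) := by
  intro a j q t hq hqc _
  have hlen : ∀ i, 0 ≤ R.len i := fun i => (hR.len_pos i).le
  have ht : 0 ≤ t := by
    rcases hq with ⟨i, s, -, hs, hs', -, rfl⟩ | ⟨i, s, -, hs, hs', -, rfl⟩
    · exact add_nonneg (Finset.sum_nonneg fun i _ => by split_ifs <;> simp [hlen]) hs
    · exact add_nonneg (Finset.sum_nonneg fun i _ => by split_ifs <;> simp [hlen]) (by linarith)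
  obtain ⟨tri, -, htri, -⟩ := hP
  rcases htri a with ⟨h0, -⟩ | hB
  · rw [h0]
    positivity
  obtain ⟨n, τ, u, e, f, hdet, hfr⟩ := hB.exists_isFrame hR
  obtain ⟨hlam, hBΔ, hcB, -⟩ := hB
  have hint := hR.marked_interior j
  have hne : (interior R.carrier).Nonempty := ⟨_, hint⟩
  obtain ⟨hf0, he0⟩ := hR.isFrame_horizontal_eq hne (g a) hfr hBΔ hlam hdet
  rcases hq with ⟨i, s, hi, hs, hs', hqi, rfl⟩ | ⟨i, s, hi, hs, hs', hqi, rfl⟩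
  · obtain ⟨hdir, hV⟩ := hR.chain_corners hg a
    have hdi := hdir _ hi
    have hVi := hV _ hi.le
    rw [stepCyc_distCyc] at hdi hVi
    have hq : q ∈ R.carrier := by
      convert hR.edge_mem_carrier i hs hs' using 1
      exact funext hqi
    have hd := hR.dir_zero_ne_zero hqi hqc
    have hside : ∀ z ∈ R.carrier,
        ((1 : ℤ) : ℝ) * (f 0 * (z 1 - q 1) - R.dir i 1 * (z 0 - q 0)) ≤ 0 := by
      intro z hz
      have := hR.det_nonpos hne i hz
      rw [hf0, ← hdi, hqi 0, hqi 1]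
      push_cast
      linarith
    convert hfr.le_of_notMem hBΔ (Or.inl rfl) hdet hq (interior_subset hint) (hcB j) hqc ht
      ?_ (by rw [hf0, ← hdi]; exact hd) hside using 4
    · rw [hf0, he0, sub_neg_eq_add]
    · rw [hqi 0, hVi, hdi, hf0]
      ring
  · obtain ⟨hdir, hV⟩ := hR.chain_corners hg (a - 1)
    rw [sub_add_cancel] at hdir hV
    have hdi := hdir _ hi
    have hVi := hV _ hi.le
    have hVa := hV _ le_rfl
    have hpred := stepCyc_chainLen (g (a - 1)) (g a)
    rw [stepCyc_distCyc] at hdi hVi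
    rw [hpred] at hVa
    have hN := chainLen_le (g (a - 1)) (g a)
    have hdp := hdir (chainLen (g (a - 1)) (g a) - 1) (by omega)
    obtain ⟨N, hNe⟩ : ∃ N, chainLen (g (a - 1)) (g a) = N + 1 :=
      ⟨_, (Nat.succ_pred (by omega)).symm⟩
    rw [hNe, stepCyc_succ, ← eq_sub_iff_add_eq] at hpred
    rw [hNe, Nat.add_sub_cancel, hpred] at hdp
    have hsum : (∑ i' : Fin d, if distCyc (g (a - 1)) i < distCyc (g (a - 1)) i' ∧
          distCyc (g (a - 1)) i' < chainLen (g (a - 1)) (g a) then R.len i' else 0) =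
        (∑ i', if distCyc (g (a - 1)) i' < chainLen (g (a - 1)) (g a) then R.len i' else 0) -
          ((∑ i', if distCyc (g (a - 1)) i' < distCyc (g (a - 1)) i then R.len i' else 0) +
            R.len i) := by
      have := sum_distCyc_lt_succ R.len (g (a - 1)) (distCyc_lt (g (a - 1)) i)
      rw [stepCyc_distCyc] at this
      rw [← this, ← Finset.sum_sub_distrib]
      refine Finset.sum_congr rfl fun i' _ => ?_
      split_ifs <;> first | omega | simp
    have hq : q ∈ R.carrier := by
      convert hR.edge_mem_carrier i hs hs' using 1
      exact funext hqi
    have hd := hR.dir_zero_ne_zero hqi hqc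
    have hside : ∀ z ∈ R.carrier,
        ((-1 : ℤ) : ℝ) * (e 0 * (z 1 - q 1) - -R.dir i 1 * (z 0 - q 0)) ≤ 0 := by
      intro z hz
      have := hR.det_nonpos hne i hz
      rw [he0, hdp, ← hdi, hqi 0, hqi 1]
      push_cast
      linarith
    have hdet' : detZ f e = -1 := by
      rw [detZ] at hdet ⊢
      linarith
    convert hfr.swap.le_of_notMem hBΔ (Or.inr rfl) hdet' hq (interior_subset hint) (hcB j) hqc ht
      ?_ (by rw [he0, hdp, ← hdi]; exact neg_ne_zero.2 hd) hside using 3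
    · rw [← abs_neg, hf0, he0]
      push_cast
      ring_nf
    · rw [hsum, hqi 0, hVi, hVa, hdi, he0, hdp]
      push_cast
      ring
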